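/- Let a be the almost analytic extension of a^φ (analytic and a trigonometric polynomial in ξ, almost analytic in x) and let K̂_a be the associated real contact field on C × T*C^d. Then for every compact subset Ω ⋐ T*C^d there is a constant C_Ω ∈ (0,∞) such that for all (s,ρ) ∈ C × Ω: K̂_a(Λ)(s,ρ) ≥ −(1/2) Im a(Re ρ) − C_Ω |Im ρ|³, where Λ(s,x,ξ) = −Im s − ⟨Im x, Re ξ⟩. -/

import Mathlib

/- Statement 8 (estimate (4.14)): the real contact field K̂_a applied to the function
   Λ(s,x,ξ) = −Im s − ⟨Im x, Re ξ⟩ satisfies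
   K̂_a(Λ)(s,ρ) ≥ −(1/2) Im a(Re ρ) − C_Ω |Im ρ|³ on compacts. -/

open scoped BigOperators Classical
open MeasureTheory

noncomputable section

open scoped BigOperators Classical
open MeasureTheory

noncomputable section

/-- ℝ^d as a Euclidean space. -/
abbrev Rd (d : ℕ) := EuclideanSpace ℝ (Fin d)

def vecR {d : ℕ} (v : Fin d → ℝ) : Rd d := (WithLp.equiv 2 (Fin d → ℝ)).symm v

/-- The real vector attached to a lattice vector `ℓ ∈ ℤ^d`. -/
def zvec {d : ℕ} (ℓ : Fin d → ℤ) : Rd d := vecR fun i => (ℓ i : ℝ)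

/-- Euclidean norm of a lattice vector. -/
def znorm {d : ℕ} (ℓ : Fin d → ℤ) : ℝ := ‖zvec ℓ‖

/-- Japanese bracket ⟨θ⟩. -/
def jap (θ : ℝ) : ℝ := Real.sqrt (1 + θ ^ 2)

/-- `C_b^∞`: smooth and bounded with all derivatives. -/
def CbSmooth {E F : Type*} [NormedAddCommGroup E] [NormedSpace ℝ E]
    [NormedAddCommGroup F] [NormedSpace ℝ F] (f : E → F) : Prop :=
  ContDiff ℝ (⊤ : ℕ∞) f ∧ ∀ n : ℕ, ∃ M : ℝ, ∀ x, ‖iteratedFDeriv ℝ n f x‖ ≤ M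

/-- Hypothesis 2.1 of the paper: conditions on the on-site potentials `D` and the
pair interactions `W` (with interaction radius `R`). -/
structure Hyp21 (d : ℕ) (R : ℝ) (D : Rd d → ℝ → ℝ)
    (W : Rd d → (Fin d → ℤ) → ℝ → ℝ) : Prop where
  smoothD : ContDiff ℝ (⊤ : ℕ∞) fun p : Rd d × ℝ => D p.1 p.2
  growth : ∃ C > (0:ℝ), ∃ Ct > (0:ℝ), ∃ κ > (0:ℝ), ∃ L > (2:ℝ),
    (∀ (x : Rd d) (θ : ℝ) (ν : ℕ), ν ≤ 2 →
      |iteratedDeriv ν (D x) θ| ≤ C * jap θ ^ (L - (ν : ℝ))) ∧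
    (∀ (x : Rd d) (θ : ℝ), -C ≤ iteratedDeriv 2 (D x) θ) ∧
    (∀ (x : Rd d) (θ : ℝ),
      |iteratedDeriv 2 (D x) θ - iteratedDeriv 2 (D x) 0| ≤ C * |deriv (D x) θ|) ∧
    (∀ (x : Rd d) (θ : ℝ),
      Ct * max (|θ| ^ (1 + κ)) |θ| ≤ deriv (D x) θ * Real.sign θ)
  DxxCb : CbSmooth fun x : Rd d => iteratedDeriv 2 (D x) 0
  gap : 2 * sInf (Set.range fun x : Rd d => iteratedDeriv 2 (D x) 0)
      > sSup (Set.range fun x : Rd d => iteratedDeriv 2 (D x) 0)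
  smoothW : ∀ ℓ : Fin d → ℤ, 0 < znorm ℓ → znorm ℓ ≤ R →
    ContDiff ℝ (⊤ : ℕ∞) fun p : Rd d × ℝ => W p.1 ℓ p.2
  evenW : ∀ x ℓ θ, W x ℓ θ = W x (-ℓ) θ ∧ W x ℓ θ = W x ℓ (-θ)
  nonnegW : ∀ x ℓ θ, 0 ≤ W x ℓ θ
  W0 : ∀ x ℓ, W x ℓ 0 = 0
  Wunit : ∀ x ℓ, znorm ℓ = 1 → 1 ≤ iteratedDeriv 2 (W x ℓ) 0
  Wbdd : ∀ ℓ : Fin d → ℤ, ∃ M : ℝ, ∀ x θ,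
    |iteratedDeriv 2 (W x ℓ) θ| + |iteratedDeriv 3 (W x ℓ) θ| ≤ M
  WxxCb : ∀ ℓ : Fin d → ℤ, CbSmooth fun x : Rd d => iteratedDeriv 2 (W x ℓ) 0

/-- Sum over the lattice vectors `ℓ ∈ ℤ^d` with `0 < |ℓ| ≤ R`. -/
def rsum {d : ℕ} (R : ℝ) (f : (Fin d → ℤ) → ℝ) : ℝ :=
  ∑' ℓ : Fin d → ℤ, if 0 < znorm ℓ ∧ znorm ℓ ≤ R then f ℓ else 0

def rsumC {d : ℕ} (R : ℝ) (f : (Fin d → ℤ) → ℂ) : ℂ :=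
  ∑' ℓ : Fin d → ℤ, if 0 < znorm ℓ ∧ znorm ℓ ≤ R then f ℓ else 0

/-- `V(x,ℓ) = J ∂_θ² W(x,ℓ,0)`. -/
def Vc {d : ℕ} (J : ℝ) (W : Rd d → (Fin d → ℤ) → ℝ → ℝ) (x : Rd d) (ℓ : Fin d → ℤ) : ℝ :=
  J * iteratedDeriv 2 (W x ℓ) 0

/-- `U_h(x) = ∂_θ²D(x,0) + J Σ_{0<|ℓ|≤R} ∂_θ²W(x+hℓ/2,ℓ,0)`. -/
def Uh {d : ℕ} (R J h : ℝ) (D : Rd d → ℝ → ℝ) (W : Rd d → (Fin d → ℤ) → ℝ → ℝ)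
    (x : Rd d) : ℝ :=
  iteratedDeriv 2 (D x) 0 +
    rsum R fun ℓ => J * iteratedDeriv 2 (W (x + (h / 2) • zvec ℓ) ℓ) 0

/-- The matrix elements of the formal Hessian `E''(0)`, indexed by lattice sites
(represented by integer vectors; the site `x ∈ ℤ^d` corresponds to the point `h x ∈ ℝ^d`). -/
def hessEntry {d : ℕ} (R J h : ℝ) (D : Rd d → ℝ → ℝ) (W : Rd d → (Fin d → ℤ) → ℝ → ℝ)
    (x y : Fin d → ℤ) : ℝ :=
  if x = y then Uh R J h D W (h • zvec x)
  else if znorm (x - y) ≤ R then -(Vc J W ((h / 2) • (zvec x + zvec y)) (x - y)) else 0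

/-- `U(x) = ∂_θ²D(x,0) + Σ_{0<|ℓ|≤R} V(x,ℓ)`. -/
def Ufun {d : ℕ} (R J : ℝ) (D : Rd d → ℝ → ℝ) (W : Rd d → (Fin d → ℤ) → ℝ → ℝ)
    (x : Rd d) : ℝ :=
  iteratedDeriv 2 (D x) 0 + rsum R fun ℓ => Vc J W x ℓ

/-- The Hamilton function `H = T − U`. -/
def Ham {d : ℕ} (R J : ℝ) (D : Rd d → ℝ → ℝ) (W : Rd d → (Fin d → ℤ) → ℝ → ℝ)
    (x p : Rd d) : ℝ :=
  rsum R (fun ℓ => Vc J W x ℓ * Real.exp (-(∑ i, (ℓ i : ℝ) * p i))) - Ufun R J D W x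

/-- The conjugated principal symbol `a^φ(x,ξ) = i Ṽ(x, ξ + iφ'(x)) − i U(x)`. -/
def aphi {d : ℕ} (R J : ℝ) (D : Rd d → ℝ → ℝ) (W : Rd d → (Fin d → ℤ) → ℝ → ℝ)
    (φ : Rd d → ℝ) (x ξ : Rd d) : ℂ :=
  Complex.I * rsumC R (fun ℓ => ((Vc J W x ℓ : ℝ) : ℂ) *
      Complex.exp (Complex.I * ((∑ i, (ℓ i : ℝ) * ξ i : ℝ) : ℂ)
        - ((∑ i, (ℓ i : ℝ) * (gradient φ x) i : ℝ) : ℂ)))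
    - Complex.I * ((Ufun R J D W x : ℝ) : ℂ)

/-- The Hamiltonian vector field `X_H`. -/
def XH {d : ℕ} (H : Rd d → Rd d → ℝ) (ρ : Rd d × Rd d) : Rd d × Rd d :=
  (gradient (fun p => H ρ.1 p) ρ.2, -gradient (fun z => H z ρ.2) ρ.1)

def IsHamCurve {d : ℕ} (H : Rd d → Rd d → ℝ) (ρ : ℝ → Rd d × Rd d) : Prop :=
  ∀ t : ℝ, HasDerivAt ρ (XH H (ρ t)) t

/-- `ℂ^d`. -/
abbrev Cd (d : ℕ) := EuclideanSpace ℂ (Fin d)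

def cvec {d : ℕ} (v : Fin d → ℂ) : Cd d := (WithLp.equiv 2 (Fin d → ℂ)).symm v

def cbasis (d : ℕ) (i : Fin d) : Cd d := EuclideanSpace.single i (1 : ℂ)

/-- Embedding of `ℝ^d` into `ℂ^d`. -/
def toCd {d : ℕ} (x : Rd d) : Cd d := cvec fun i => ((x i : ℝ) : ℂ)

/-- Complexified phase space `T*ℂ^d ≅ ℂ^d × ℂ_d`. -/
abbrev PS (d : ℕ) := Cd d × Cd d

/-- Real part `Re ρ` of a point of `T*ℂ^d`. -/
def rePS {d : ℕ} (z : PS d) : PS d :=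
  (cvec fun i => (((z.1 i).re : ℝ) : ℂ), cvec fun i => (((z.2 i).re : ℝ) : ℂ))

/-- `|Im ρ|` for `ρ ∈ T*ℂ^d`. -/
def imNormPS {d : ℕ} (z : PS d) : ℝ :=
  Real.sqrt ((∑ i, (z.1 i).im ^ 2) + ∑ i, (z.2 i).im ^ 2)

/-- A point of `T*ℂ^d` is real. -/
def IsRealPS {d : ℕ} (z : PS d) : Prop := ∀ i, (z.1 i).im = 0 ∧ (z.2 i).im = 0

/-- Holomorphic (Wirtinger) directional derivative `∂f/∂z` in the direction `v`. -/
def dholAt {E : Type*} [NormedAddCommGroup E] [NormedSpace ℂ E]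
    (f : E → ℂ) (z v : E) : ℂ :=
  (fderiv ℝ f z v - Complex.I * fderiv ℝ f z (Complex.I • v)) / 2

/-- Antiholomorphic (Wirtinger) directional derivative `∂f/∂z̄` in the direction `v`. -/
def dbarAt {E : Type*} [NormedAddCommGroup E] [NormedSpace ℂ E]
    (f : E → ℂ) (z v : E) : ℂ :=
  (fderiv ℝ f z v + Complex.I * fderiv ℝ f z (Complex.I • v)) / 2

/-- The real Hamilton field `X̂_a = X_a + conj(X_a)` of `a`, written through its complex
components `(a'_ξ, −a'_x)` (a real tangent vector of `T*ℂ^d`). -/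
def Xvec {d : ℕ} (a : PS d → ℂ) (z : PS d) : PS d :=
  (cvec fun i => dholAt (fun ξ => a (z.1, ξ)) z.2 (cbasis d i),
   cvec fun i => -dholAt (fun x => a (x, z.2)) z.1 (cbasis d i))

/-- The elementary action `A = ⟨ξ, a'_ξ⟩ − a`. -/
def Act {d : ℕ} (a : PS d → ℂ) (z : PS d) : ℂ :=
  (∑ i, z.2 i * dholAt (fun ξ => a (z.1, ξ)) z.2 (cbasis d i)) - a z

/-- The function `Λ(s,x,ξ) = −Im s − ⟨Im x, Re ξ⟩` on `ℂ × T*ℂ^d`. -/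
def Lam {d : ℕ} (p : ℂ × PS d) : ℝ :=
  -p.1.im - ∑ i, (p.2.1 i).im * (p.2.2 i).re

/-- The real contact field `K̂_a = −A ∂_s + X̂_a` on `ℂ × T*ℂ^d`, written through its
complex components. -/
def Kvec {d : ℕ} (a : PS d → ℂ) (p : ℂ × PS d) : ℂ × PS d :=
  (-(Act a p.2), Xvec a p.2)

/-- `a : T*ℂ^d → ℂ` is an almost analytic extension of the symbol `aφ`:
smooth, holomorphic in `ξ`, restricting to `aφ` on the real domain, with `∂̄_x a`
vanishing to infinite order on the real domain, and `2π`-periodic in `Re ξ`. -/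
structure IsAAExt (d : ℕ) (aφ : Rd d → Rd d → ℂ) (a : PS d → ℂ) : Prop where
  smooth : ContDiff ℝ (⊤ : ℕ∞) a
  holoξ : ∀ x : Cd d, Differentiable ℂ fun ξ => a (x, ξ)
  restrict : ∀ x ξ : Rd d, a (toCd x, toCd ξ) = aφ x ξ
  aa : ∀ K : Set (PS d), IsCompact K → ∀ N : ℕ, ∃ C : ℝ, ∀ z ∈ K, ∀ i : Fin d,
    ‖dbarAt (fun x => a (x, z.2)) z.1 (cbasis d i)‖ ≤ C * imNormPS z ^ N
  periodic : ∀ (z : PS d) (e : Fin d → ℤ),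
    a (z.1, z.2 + toCd ((2 * Real.pi) • zvec e)) = a z

theorem ContDiff.exists_lipschitz_bound {E G : Type*} [NormedAddCommGroup E] [NormedSpace ℝ E]
    [ProperSpace E] [NormedAddCommGroup G] [NormedSpace ℝ G] {g : E → G} (hg : ContDiff ℝ 1 g)
    (M : ℝ) : ∃ K : ℝ, ∀ x v : E, ‖x‖ + ‖v‖ ≤ M → ‖g (x + v) - g x‖ ≤ K * ‖v‖ := by
  obtain ⟨K, hK⟩ := (isCompact_closedBall (0 : E) M).exists_bound_of_continuousOn
    (hg.continuous_fderiv one_ne_zero).continuousOn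
  refine ⟨K, fun x v hxv => ?_⟩
  have hx : x ∈ Metric.closedBall (0 : E) M := by
    rw [mem_closedBall_zero_iff]; linarith [norm_nonneg v]
  have hy : x + v ∈ Metric.closedBall (0 : E) M := by
    rw [mem_closedBall_zero_iff]; linarith [norm_add_le x v]
  simpa using (convex_closedBall (0 : E) M).norm_image_sub_le_of_norm_fderiv_le (𝕜 := ℝ)
    (fun z _ => (hg.differentiable one_ne_zero) z) hK hx hy

theorem exists_taylor_bound {E F : Type*} [NormedAddCommGroup E] [NormedSpace ℝ E] [ProperSpace E]
    [NormedAddCommGroup F] [NormedSpace ℝ F] {f : E → F} (hf : ContDiff ℝ (⊤ : ℕ∞) f) (M : ℝ) :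
    ∃ K : ℝ, 0 ≤ K ∧ ∀ x v : E, ‖x‖ + ‖v‖ ≤ M →
      ‖fderiv ℝ f (x + v) v - fderiv ℝ f x v - fderiv ℝ (fderiv ℝ f) x v v‖ ≤ K * ‖v‖ ^ 3 ∧
      ‖f (x + v) - f x - fderiv ℝ f x v - (1 / 2 : ℝ) • fderiv ℝ (fderiv ℝ f) x v v‖
        ≤ K * ‖v‖ ^ 3 := by
  have h1 : ContDiff ℝ (⊤ : ℕ∞) (fderiv ℝ f) := hf.fderiv_right (by simp)
  have h2 : ContDiff ℝ (⊤ : ℕ∞) (fderiv ℝ (fderiv ℝ f)) := h1.fderiv_right (by simp)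
  obtain ⟨K, hK⟩ := (h2.of_le (by simp)).exists_lipschitz_bound M
  have hD2 : ∀ x v : E, ‖x‖ + ‖v‖ ≤ M →
      ‖fderiv ℝ (fderiv ℝ f) (x + v) - fderiv ℝ (fderiv ℝ f) x‖ ≤ |K| * ‖v‖ := fun x v hxv =>
    (hK x v hxv).trans (by gcongr; exact le_abs_self K)
  have hD1 : ∀ x v : E, ‖x‖ + ‖v‖ ≤ M →
      ‖fderiv ℝ f (x + v) - fderiv ℝ f x - fderiv ℝ (fderiv ℝ f) x v‖ ≤ |K| * ‖v‖ ^ 2 := by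
    intro x v hxv
    have := (convex_closedBall x ‖v‖).norm_image_sub_le_of_norm_fderiv_le' (𝕜 := ℝ)
      (f := fderiv ℝ f) (C := |K| * ‖v‖) (x := x) (y := x + v) (φ := fderiv ℝ (fderiv ℝ f) x)
      (fun z _ => (h1.differentiable (by simp)) z)
      (fun z hz => by
        rw [mem_closedBall_iff_norm] at hz
        have h := hD2 x (z - x) (by linarith)
        rw [add_sub_cancel] at h
        exact h.trans (by gcongr))
      (by simp) (by simp)
    simpa [pow_two, mul_assoc] using this
  have hD1' : ∀ x v w : E, ‖x‖ + ‖v‖ ≤ M →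
      ‖fderiv ℝ f (x + v) w - fderiv ℝ f x w - fderiv ℝ (fderiv ℝ f) x v w‖
        ≤ |K| * ‖v‖ ^ 2 * ‖w‖ := by
    intro x v w hxv
    exact (fderiv ℝ f (x + v) - fderiv ℝ f x - fderiv ℝ (fderiv ℝ f) x v).le_of_opNorm_le
      (hD1 x v hxv) w
  refine ⟨|K|, abs_nonneg K, fun x v hxv => ⟨(hD1' x v v hxv).trans (le_of_eq (by ring)), ?_⟩⟩
  let p : ℝ → F := fun t => f (x + t • v) - t • fderiv ℝ f x v
    - (t ^ 2 * (1 / 2 : ℝ)) • fderiv ℝ (fderiv ℝ f) x v v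
  have hp : ∀ t : ℝ, HasDerivAt p (fderiv ℝ f (x + t • v) v - fderiv ℝ f x v
      - fderiv ℝ (fderiv ℝ f) x (t • v) v) t := by
    intro t
    have hl : HasDerivAt (fun t : ℝ => x + t • v) v t := by
      simpa using ((hasDerivAt_id t).smul_const v).const_add x
    have ha := ((hf.differentiable (by simp)) (x + t • v)).hasFDerivAt.comp_hasDerivAt t hl
    have hb := (hasDerivAt_id t).smul_const (fderiv ℝ f x v)
    have hc := (((hasDerivAt_id t).pow 2).mul_const (1 / 2 : ℝ)).smul_const
      (fderiv ℝ (fderiv ℝ f) x v v)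
    refine ((ha.sub hb).sub hc).congr_deriv ?_
    simp only [map_smul, smul_apply, one_smul, id]
    congr 2
    push_cast
    ring
  have := norm_image_sub_le_of_norm_deriv_le_segment_01' (f := p) (C := |K| * ‖v‖ ^ 3)
    (fun t _ => (hp t).hasDerivWithinAt) (fun t ht => by
      have hn : ‖t • v‖ ≤ ‖v‖ := by
        rw [norm_smul, Real.norm_of_nonneg ht.1]
        exact mul_le_of_le_one_left (norm_nonneg v) ht.2.le
      refine (hD1' x (t • v) v (by linarith)).trans ?_
      calc |K| * ‖t • v‖ ^ 2 * ‖v‖ ≤ |K| * ‖v‖ ^ 2 * ‖v‖ := by gcongr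
        _ = |K| * ‖v‖ ^ 3 := by ring)
  convert this using 2
  simp [p]
  abel

theorem IsLocalMin.iteratedDeriv_two_nonneg {g : ℝ → ℝ} {θ : ℝ}
    (hmin : IsLocalMin g θ) (hg : ContinuousAt g θ) : 0 ≤ iteratedDeriv 2 g θ := by
  rw [iteratedDeriv_succ, iteratedDeriv_one]
  by_contra! hneg
  have hmax := isLocalMax_of_deriv_deriv_neg hneg hmin.deriv_eq_zero hg
  have hconst : g =ᶠ[nhds θ] fun _ => g θ := by
    filter_upwards [hmin, hmax] with t h1 h2 using le_antisymm h2 h1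
  have : deriv (deriv g) θ = 0 := by
    rw [hconst.deriv.deriv_eq]
    simp
  exact hneg.ne this

theorem finite_setOf_znorm_le (d : ℕ) (R : ℝ) : {ℓ : Fin d → ℤ | znorm ℓ ≤ R}.Finite := by
  refine (Set.finite_Icc (fun _ => -⌈R⌉ : Fin d → ℤ) (fun _ => ⌈R⌉)).subset fun ℓ hℓ => ?_
  have h : ∀ i, |(ℓ i : ℝ)| ≤ (⌈R⌉ : ℤ) := fun i =>
    ((PiLp.norm_apply_le (zvec ℓ) i).trans hℓ).trans (Int.le_ceil R)
  have h' : ∀ i, |ℓ i| ≤ ⌈R⌉ := fun i => by exact_mod_cast h i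
  exact ⟨fun i => (abs_le.mp (h' i)).1, fun i => (abs_le.mp (h' i)).2⟩

theorem summable_range_cutoff {d : ℕ} {E : Type*} [AddCommMonoid E] [TopologicalSpace E]
    (R : ℝ) (f : (Fin d → ℤ) → E) :
    Summable fun ℓ => if 0 < znorm ℓ ∧ znorm ℓ ≤ R then f ℓ else 0 := by
  refine summable_of_hasFiniteSupport ((finite_setOf_znorm_le d R).subset fun ℓ hℓ => ?_)
  by_contra h
  exact hℓ (if_neg fun h' => h h'.2)

theorem Hyp21.Vc_nonneg {d : ℕ} {R J : ℝ} {D : Rd d → ℝ → ℝ} {W : Rd d → (Fin d → ℤ) → ℝ → ℝ}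
    (hyp : Hyp21 d R D W) (hJ : 0 ≤ J) (x : Rd d) {ℓ : Fin d → ℤ} (h0 : 0 < znorm ℓ)
    (hR : znorm ℓ ≤ R) : 0 ≤ Vc J W x ℓ := by
  refine mul_nonneg hJ (IsLocalMin.iteratedDeriv_two_nonneg ?_ ?_)
  · exact Filter.Eventually.of_forall fun θ => by rw [hyp.W0]; exact hyp.nonnegW x ℓ θ
  · have := (hyp.smoothW ℓ h0 hR).continuous
    exact (this.comp (Continuous.prodMk_right x)).continuousAt

theorem Hyp21.aphi_im_le_Ham {d : ℕ} {R J : ℝ} {D : Rd d → ℝ → ℝ}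
    {W : Rd d → (Fin d → ℤ) → ℝ → ℝ} (hyp : Hyp21 d R D W) (hJ : 0 ≤ J) (φ : Rd d → ℝ)
    (x ξ : Rd d) : (aphi R J D W φ x ξ).im ≤ Ham R J D W x (gradient φ x) := by
  have him : ∀ (T : ℂ) (u : ℝ), (Complex.I * T - Complex.I * (u : ℂ)).im = T.re - u := by
    intro T u; simp
  rw [aphi, him, Ham, rsumC, rsum, Complex.re_tsum (summable_range_cutoff R _)]
  refine sub_le_sub_right (Summable.tsum_le_tsum (fun ℓ => ?_)
    (Complex.reCLM.summable (summable_range_cutoff R _)) (summable_range_cutoff R _)) _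
  split_ifs with h
  · rw [Complex.reCLM_apply, Complex.re_ofReal_mul]
    refine mul_le_mul_of_nonneg_left ?_ (hyp.Vc_nonneg hJ x h.1 h.2)
    refine (Complex.re_le_norm _).trans (le_of_eq ?_)
    rw [Complex.norm_exp]
    simp
  · simp

/-- Embedding of the real phase space into the complexified one. -/
def ofRealPS {d : ℕ} (p : Rd d × Rd d) : PS d := (toCd p.1, toCd p.2)

/-- The real vector underlying `Re ρ`. -/
def reR {d : ℕ} (z : PS d) : Rd d × Rd d :=
  (vecR fun i => (z.1 i).re, vecR fun i => (z.2 i).re)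

/-- The real vector underlying `Im ρ`. -/
def imR {d : ℕ} (z : PS d) : Rd d × Rd d :=
  (vecR fun i => (z.1 i).im, vecR fun i => (z.2 i).im)

section RealPoints

variable {d : ℕ}

@[simp] theorem cvec_apply (v : Fin d → ℂ) (i : Fin d) : cvec v i = v i := rfl

@[simp] theorem toCd_apply (x : Rd d) (i : Fin d) : toCd x i = (x i : ℂ) := rfl

@[simp] theorem vecR_apply (v : Fin d → ℝ) (i : Fin d) : vecR v i = v i := rfl

theorem rePS_eq (z : PS d) : rePS z = ofRealPS (reR z) := rfl

theorem PS.ext_apply {z w : PS d} (h1 : ∀ i, z.1 i = w.1 i) (h2 : ∀ i, z.2 i = w.2 i) : z = w :=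
  Prod.ext (PiLp.ext h1) (PiLp.ext h2)

theorem re_add_I_smul_im (z : PS d) :
    ofRealPS (reR z) + Complex.I • ofRealPS (imR z) = z := by
  refine PS.ext_apply (fun i => ?_) (fun i => ?_) <;>
    simp [ofRealPS, reR, imR, mul_comm Complex.I, Complex.re_add_im]

theorem ofRealPS_add_smul (p q : Rd d × Rd d) (t : ℝ) :
    ofRealPS (p + t • q) = ofRealPS p + t • ofRealPS q := by
  refine PS.ext_apply (fun i => ?_) (fun i => ?_) <;> simp [ofRealPS]

theorem imNormPS_ofRealPS_add_smul (p : Rd d × Rd d) (t : ℝ) (v : PS d) :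
    imNormPS (ofRealPS p + t • v) = |t| * imNormPS v := by
  unfold imNormPS
  rw [← Real.sqrt_sq_eq_abs, ← Real.sqrt_mul (sq_nonneg t)]
  simp [ofRealPS, mul_add, Finset.mul_sum, mul_pow]

theorem norm_ofRealPS_reR_le (z : PS d) : ‖ofRealPS (reR z)‖ ≤ ‖z‖ := by
  refine max_le_max ?_ ?_ <;> rw [EuclideanSpace.norm_eq, EuclideanSpace.norm_eq] <;> gcongr <;>
    simp [ofRealPS, reR, Complex.abs_re_le_norm]

theorem norm_ofRealPS_imR_le (z : PS d) : ‖ofRealPS (imR z)‖ ≤ ‖z‖ := by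
  refine max_le_max ?_ ?_ <;> rw [EuclideanSpace.norm_eq, EuclideanSpace.norm_eq] <;> gcongr <;>
    simp [ofRealPS, imR, Complex.abs_im_le_norm]

theorem norm_ofRealPS_imR_le_imNormPS (z : PS d) : ‖ofRealPS (imR z)‖ ≤ imNormPS z := by
  refine max_le ?_ ?_ <;> rw [EuclideanSpace.norm_eq] <;> refine Real.sqrt_le_sqrt ?_ <;>
    simp [ofRealPS, imR, Finset.sum_nonneg, sq_nonneg]

theorem ofRealPS_eq_sum (p : Rd d × Rd d) :
    ofRealPS p = ∑ i, (p.1 i • ((cbasis d i, 0) : PS d) + p.2 i • ((0, cbasis d i) : PS d)) := by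
  refine Prod.ext ?_ ?_ <;> ext j <;>
    simp [ofRealPS, cbasis, Prod.fst_sum, Prod.snd_sum, Pi.single_apply]

theorem map_ofRealPS (L : PS d →L[ℝ] ℂ) (p : Rd d × Rd d) :
    L (ofRealPS p) = ∑ i, (p.1 i * L (cbasis d i, 0) + p.2 i * L (0, cbasis d i)) := by
  rw [ofRealPS_eq_sum]
  simp only [map_sum, map_add, map_smul, Complex.real_smul]

theorem map_I_smul_ofRealPS (L : PS d →L[ℝ] ℂ) (p : Rd d × Rd d) :
    L (Complex.I • ofRealPS p) =
      ∑ i, (p.1 i * L (Complex.I • cbasis d i, 0) + p.2 i * L (0, Complex.I • cbasis d i)) := by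
  have hL : ∀ (r : ℝ) (v : PS d), L (Complex.I • r • v) = r * L (Complex.I • v) := fun r v => by
    rw [smul_comm, map_smul, Complex.real_smul]
  rw [ofRealPS_eq_sum, Finset.smul_sum]
  simp only [smul_add, map_sum, map_add, hL]
  simp only [Prod.smul_mk, smul_zero]

end RealPoints

section ContactField

variable {d : ℕ}

theorem fderiv_Lam_apply (p w : ℂ × PS d) :
    fderiv ℝ Lam p w = -w.1.im
      - ∑ i, ((w.2.1 i).im * (p.2.2 i).re + (p.2.1 i).im * (w.2.2 i).re) := by
  have hdiff : DifferentiableAt ℝ (Lam (d := d)) p := by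
    change DifferentiableAt ℝ (fun p : ℂ × PS d => -Complex.imCLM p.1
      - ∑ i, Complex.imCLM (p.2.1 i) * Complex.reCLM (p.2.2 i)) p
    fun_prop
  rw [← hdiff.lineDeriv_eq_fderiv, lineDeriv]
  have hpoly : (fun t : ℝ => Lam (p + t • w)) = fun t => Lam p
      + t * (-w.1.im - ∑ i, ((w.2.1 i).im * (p.2.2 i).re + (p.2.1 i).im * (w.2.2 i).re))
      + t ^ 2 * (-∑ i, (w.2.1 i).im * (w.2.2 i).re) := by
    funext t
    have hsum : ∑ i, ((p + t • w).2.1 i).im * ((p + t • w).2.2 i).re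
        = ∑ i, (p.2.1 i).im * (p.2.2 i).re
          + t * ∑ i, ((w.2.1 i).im * (p.2.2 i).re + (p.2.1 i).im * (w.2.2 i).re)
          + t ^ 2 * ∑ i, (w.2.1 i).im * (w.2.2 i).re := by
      simp only [Finset.mul_sum, ← Finset.sum_add_distrib]
      refine Finset.sum_congr rfl fun i _ => ?_
      simp
      ring
    have him : (p + t • w).1.im = p.1.im + t * w.1.im := by simp
    rw [Lam, Lam, hsum, him]
    ring
  rw [hpoly]
  refine HasDerivAt.deriv ?_
  refine ((((hasDerivAt_id (0 : ℝ)).mul_const _).const_add _).add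
    (((hasDerivAt_id (0 : ℝ)).pow 2).mul_const _)).congr_deriv ?_
  simp

variable {a : PS d → ℂ}

theorem fderiv_comp_prodMk_left (ha : Differentiable ℝ a) (z : PS d) (v : Cd d) :
    fderiv ℝ (fun x => a (x, z.2)) z.1 v = fderiv ℝ a z (v, 0) := by
  have h := (ha z).hasFDerivAt.comp z.1 (hasFDerivAt_prodMk_left (𝕜 := ℝ) z.1 z.2)
  have h' : HasFDerivAt (fun x => a (x, z.2)) _ z.1 := h
  rw [h'.fderiv]
  simp

theorem fderiv_comp_prodMk_right (ha : Differentiable ℝ a) (z : PS d) (v : Cd d) :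
    fderiv ℝ (fun ξ => a (z.1, ξ)) z.2 v = fderiv ℝ a z (0, v) := by
  have h := (ha z).hasFDerivAt.comp z.2 (hasFDerivAt_prodMk_right (𝕜 := ℝ) z.1 z.2)
  have h' : HasFDerivAt (fun ξ => a (z.1, ξ)) _ z.2 := h
  rw [h'.fderiv]
  simp

theorem fderiv_Lam_Kvec (ha : Differentiable ℝ a) (s : ℂ) (ρ : PS d) :
    fderiv ℝ Lam (s, ρ) (Kvec a (s, ρ)) = -(a ρ).im
      + ((fderiv ℝ a ρ (ofRealPS (imR ρ))).re
        + (fderiv ℝ a ρ (Complex.I • ofRealPS (imR ρ))).im) / 2 := by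
  rw [fderiv_Lam_apply, map_ofRealPS, map_I_smul_ofRealPS]
  simp only [Kvec, Xvec, Act, dholAt, fderiv_comp_prodMk_left ha, fderiv_comp_prodMk_right ha,
    cvec_apply, imR, vecR_apply]
  simp only [Complex.neg_im, Complex.sub_im, Complex.re_sum, Complex.im_sum,
    ← Finset.sum_add_distrib, Finset.sum_div]
  rw [neg_neg, sub_right_comm, ← Finset.sum_sub_distrib, sub_eq_neg_add]
  congr 1
  refine Finset.sum_congr rfl fun i _ => ?_
  have h2 : ∀ w : ℂ, (w / 2).re = w.re / 2 ∧ (w / 2).im = w.im / 2 := fun w => by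
    constructor <;> norm_num
  simp only [Complex.add_re, Complex.add_im, Complex.mul_re, Complex.mul_im, Complex.neg_re,
    Complex.sub_re, Complex.sub_im, h2, Complex.ofReal_re, Complex.ofReal_im, Complex.I_re,
    Complex.I_im]
  ring

end ContactField

section AlmostAnalytic

variable {d : ℕ} {aφ : Rd d → Rd d → ℂ} {a : PS d → ℂ}

theorem IsAAExt.differentiable (ha : IsAAExt d aφ a) : Differentiable ℝ a :=
  ha.smooth.differentiable (by simp)

theorem IsAAExt.fderiv_snd_I_smul (ha : IsAAExt d aφ a) (z : PS d) (v : Cd d) :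
    fderiv ℝ a z (0, Complex.I • v) = Complex.I * fderiv ℝ a z (0, v) := by
  have h := ((ha.holoξ z.1) z.2).fderiv_restrictScalars ℝ
  rw [← fderiv_comp_prodMk_right ha.differentiable, ← fderiv_comp_prodMk_right ha.differentiable, h]
  simp

theorem IsAAExt.cauchyRiemann_defect (ha : IsAAExt d aφ a) (z : PS d) (p : Rd d × Rd d) :
    fderiv ℝ a z (Complex.I • ofRealPS p) - Complex.I * fderiv ℝ a z (ofRealPS p) =
      ∑ i, p.1 i * (-2 * Complex.I * dbarAt (fun x => a (x, z.2)) z.1 (cbasis d i)) := by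
  rw [map_ofRealPS, map_I_smul_ofRealPS, Finset.mul_sum, ← Finset.sum_sub_distrib]
  refine Finset.sum_congr rfl fun i _ => ?_
  rw [dbarAt, fderiv_comp_prodMk_left ha.differentiable, fderiv_comp_prodMk_left ha.differentiable,
    ha.fderiv_snd_I_smul]
  linear_combination ((p.1 i : ℂ) * fderiv ℝ a z (Complex.I • cbasis d i, 0)) * Complex.I_sq

theorem IsAAExt.exists_cauchyRiemann_bound (ha : IsAAExt d aφ a) {K : Set (PS d)}
    (hK : IsCompact K) : ∃ C : ℝ, 0 ≤ C ∧ ∀ z ∈ K, ∀ p : Rd d × Rd d,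
      ‖fderiv ℝ a z (Complex.I • ofRealPS p) - Complex.I * fderiv ℝ a z (ofRealPS p)‖
        ≤ C * ‖ofRealPS p‖ * imNormPS z ^ 2 := by
  obtain ⟨C, hC⟩ := ha.aa K hK 2
  refine ⟨d * (2 * |C|), by positivity, fun z hz p => ?_⟩
  rw [ha.cauchyRiemann_defect]
  refine (norm_sum_le_of_le (f := _) (n := fun _ => ‖ofRealPS p‖ * (2 * (|C| * imNormPS z ^ 2)))
    Finset.univ fun i _ => ?_).trans (le_of_eq ?_)
  · have h1 : ‖((p.1 i : ℝ) : ℂ)‖ ≤ ‖ofRealPS p‖ :=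
      (PiLp.norm_apply_le (ofRealPS p).1 i).trans (norm_fst_le _)
    have h2 : ‖dbarAt (fun x => a (x, z.2)) z.1 (cbasis d i)‖ ≤ |C| * imNormPS z ^ 2 :=
      (hC z hz i).trans (by gcongr; exact le_abs_self C)
    rw [norm_mul, norm_mul, norm_mul, Complex.norm_I, norm_neg, Complex.norm_ofNat, mul_one]
    gcongr
  · simp
    ring

theorem hasDerivAt_zero_of_norm_le_sq {F : Type*} [NormedAddCommGroup F] [NormedSpace ℝ F]
    {h : ℝ → F} {C : ℝ} (hC : ∀ t : ℝ, |t| ≤ 1 → ‖h t‖ ≤ C * t ^ 2) : HasDerivAt h 0 0 := by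
  have h0 : h 0 = 0 := by simpa using hC 0 (by simp)
  rw [hasDerivAt_iff_isLittleO_nhds_zero]
  have hO : h =O[nhds 0] fun t : ℝ => t ^ 2 := by
    refine Asymptotics.IsBigO.of_bound C ?_
    filter_upwards [Metric.closedBall_mem_nhds (0 : ℝ) one_pos] with t ht
    rw [mem_closedBall_zero_iff] at ht
    simpa using hC t ht
  simpa [h0] using hO.trans_isLittleO (Asymptotics.isLittleO_pow_id one_lt_two)

theorem IsAAExt.fderiv_fderiv_I_smul (ha : IsAAExt d aφ a) (p q : Rd d × Rd d) (v : PS d) :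
    fderiv ℝ (fderiv ℝ a) (ofRealPS p) v (Complex.I • ofRealPS q) =
      Complex.I * fderiv ℝ (fderiv ℝ a) (ofRealPS p) v (ofRealPS q) := by
  have h1 : ContDiff ℝ (⊤ : ℕ∞) (fderiv ℝ a) := ha.smooth.fderiv_right (by simp)
  obtain ⟨C, -, hC⟩ := ha.exists_cauchyRiemann_bound
    (isCompact_closedBall (ofRealPS p) ‖v‖)
  have hD : HasDerivAt (fun t : ℝ => fderiv ℝ a (ofRealPS p + t • v))
      (fderiv ℝ (fderiv ℝ a) (ofRealPS p) v) 0 := by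
    have hl : HasDerivAt (fun t : ℝ => ofRealPS p + t • v) v 0 := by
      simpa using ((hasDerivAt_id (0 : ℝ)).smul_const v).const_add (ofRealPS p)
    refine HasFDerivAt.comp_hasDerivAt (0 : ℝ) ?_ hl
    simpa using ((h1.differentiable (by simp)) (ofRealPS p)).hasFDerivAt
  have hDw : ∀ w : PS d, HasDerivAt (fun t : ℝ => fderiv ℝ a (ofRealPS p + t • v) w)
      (fderiv ℝ (fderiv ℝ a) (ofRealPS p) v w) 0 := fun w => by
    simpa using hD.clm_apply (hasDerivAt_const (0 : ℝ) w)
  have hzero := hasDerivAt_zero_of_norm_le_sq (C := C * ‖ofRealPS q‖ * imNormPS v ^ 2)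
    (h := fun t : ℝ => fderiv ℝ a (ofRealPS p + t • v) (Complex.I • ofRealPS q)
      - Complex.I * fderiv ℝ a (ofRealPS p + t • v) (ofRealPS q)) fun t ht => by
        refine (hC _ ?_ q).trans (le_of_eq ?_)
        · rw [mem_closedBall_iff_norm, add_sub_cancel_left, norm_smul]
          exact mul_le_of_le_one_left (norm_nonneg v) ht
        · rw [imNormPS_ofRealPS_add_smul, mul_pow, sq_abs]
          ring
  exact sub_eq_zero.mp
    (((hDw _).sub ((hDw _).const_mul Complex.I)).unique hzero)

theorem IsAAExt.fderiv_fderiv_I_smul_I_smul (ha : IsAAExt d aφ a) (p q : Rd d × Rd d) :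
    fderiv ℝ (fderiv ℝ a) (ofRealPS p) (Complex.I • ofRealPS q) (Complex.I • ofRealPS q) =
      -fderiv ℝ (fderiv ℝ a) (ofRealPS p) (ofRealPS q) (ofRealPS q) := by
  have hsymm : IsSymmSndFDerivAt ℝ a (ofRealPS p) :=
    ha.smooth.contDiffAt.isSymmSndFDerivAt (by simp; exact WithTop.coe_le_coe.2 (le_top (a := (2 : ℕ∞))))
  rw [ha.fderiv_fderiv_I_smul, hsymm.eq, ha.fderiv_fderiv_I_smul, ← mul_assoc, Complex.I_mul_I,
    neg_one_mul]

end AlmostAnalytic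

/-- Lemma on the contact field, estimate (4.14). -/
theorem statement8 (d : ℕ) (hd : 2 ≤ d) (R J : ℝ) (hR : 1 ≤ R) (hJ : 0 < J)
    (D : Rd d → ℝ → ℝ) (W : Rd d → (Fin d → ℤ) → ℝ → ℝ) (hyp : Hyp21 d R D W)
    -- the weight function φ of the geodesic construction
    (φ : Rd d → ℝ) (K₀ : Set (Rd d)) (hφ : CbSmooth φ) (hK₀ : IsCompact K₀)
    (hle : ∀ x : Rd d, Ham R J D W x (gradient φ x) ≤ 0)
    (hiff : ∀ x : Rd d, Ham R J D W x (gradient φ x) = 0 ↔ x ∈ K₀)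
    -- the almost analytic extension a of a^φ
    (a : PS d → ℂ) (ha : IsAAExt d (aphi R J D W φ) a) :
    ∀ Ω : Set (PS d), IsCompact Ω → ∃ C > (0 : ℝ), ∀ (s : ℂ), ∀ ρ ∈ Ω,
      fderiv ℝ Lam (s, ρ) (Kvec a (s, ρ))
        ≥ -(1 / 2 : ℝ) * (a (rePS ρ)).im - C * imNormPS ρ ^ 3 := by
  have hneg : ∀ p : Rd d × Rd d, (a (ofRealPS p)).im ≤ 0 := fun p => by
    rw [ofRealPS, ha.restrict]
    exact (hyp.aphi_im_le_Ham hJ.le φ p.1 p.2).trans (hle p.1)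
  intro Ω hΩ
  obtain ⟨r, hr⟩ := hΩ.isBounded.exists_norm_le
  obtain ⟨K, hK0, hK⟩ := exists_taylor_bound ha.smooth (3 * r)
  obtain ⟨C, hC0, hC⟩ := ha.exists_cauchyRiemann_bound hΩ
  refine ⟨4 * K + C + 1, by positivity, fun s ρ hρ => ?_⟩
  have hXr : ‖ofRealPS (reR ρ)‖ ≤ r := (norm_ofRealPS_reR_le ρ).trans (hr ρ hρ)
  have hYr : ‖ofRealPS (imR ρ)‖ ≤ r := (norm_ofRealPS_imR_le ρ).trans (hr ρ hρ)
  have hYn := norm_ofRealPS_imR_le_imNormPS ρ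
  have hY0 := norm_nonneg (ofRealPS (imR ρ))
  have hI : ‖Complex.I • ofRealPS (imR ρ)‖ = ‖ofRealPS (imR ρ)‖ := by
    rw [norm_smul, Complex.norm_I, one_mul]
  have hcube : ‖ofRealPS (imR ρ)‖ ^ 3 ≤ imNormPS ρ ^ 3 := by gcongr
  have hKcube := mul_le_mul_of_nonneg_left hcube hK0
  obtain ⟨hT1, hT2⟩ := hK (ofRealPS (reR ρ)) (Complex.I • ofRealPS (imR ρ)) (by rw [hI]; linarith)
  rw [re_add_I_smul_im, hI, ha.fderiv_fderiv_I_smul_I_smul] at hT1 hT2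
  have hreal : ∀ t : ℝ, t ^ 2 = 2 → |t| ≤ 2 →
      (a (ofRealPS (reR ρ))).im + t * (fderiv ℝ a (ofRealPS (reR ρ)) (ofRealPS (imR ρ))).im
        + (fderiv ℝ (fderiv ℝ a) (ofRealPS (reR ρ)) (ofRealPS (imR ρ)) (ofRealPS (imR ρ))).im
        ≤ 4 * (K * imNormPS ρ ^ 3) := by
    intro t ht2 ht
    have htn : ‖t • ofRealPS (imR ρ)‖ = |t| * ‖ofRealPS (imR ρ)‖ := by
      rw [norm_smul, Real.norm_eq_abs]
    have htle : |t| * ‖ofRealPS (imR ρ)‖ ≤ 2 * ‖ofRealPS (imR ρ)‖ := by gcongr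
    have hT := (hK (ofRealPS (reR ρ)) (t • ofRealPS (imR ρ)) (by rw [htn]; linarith)).2
    rw [htn, ← ofRealPS_add_smul] at hT
    have hT' := (neg_le_of_abs_le ((Complex.abs_im_le_norm _).trans hT))
    have hz := hneg (reR ρ + t • imR ρ)
    have ht3 : (|t| * ‖ofRealPS (imR ρ)‖) ^ 3 ≤ 4 * ‖ofRealPS (imR ρ)‖ ^ 3 := by
      have : |t| ^ 3 = 2 * |t| := by rw [pow_succ, sq_abs, ht2]
      rw [mul_pow, this]
      gcongr
      linarith
    have hKt := mul_le_mul_of_nonneg_left ht3 hK0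
    simp only [map_smul, smul_apply, Complex.sub_im, Complex.real_smul, Complex.im_ofReal_mul]
      at hT'
    linear_combination hT' + hz + hKt + 4 * hKcube + (1 / 2 : ℝ) *
      (fderiv ℝ (fderiv ℝ a) (ofRealPS (reR ρ)) (ofRealPS (imR ρ)) (ofRealPS (imR ρ))).im * ht2.symm
  have hsq : Real.sqrt 2 ^ 2 = 2 := Real.sq_sqrt (by norm_num)
  have hsqle : |Real.sqrt 2| ≤ 2 := by
    rw [abs_of_nonneg (Real.sqrt_nonneg 2), Real.sqrt_le_left (by norm_num)]
    norm_num
  have hplus := hreal (Real.sqrt 2) hsq hsqle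
  have hminus := hreal (-Real.sqrt 2) (by rw [neg_sq, hsq]) (by rwa [abs_neg])
  have hCR := hC ρ hρ (imR ρ)
  have hCn : C * ‖ofRealPS (imR ρ)‖ * imNormPS ρ ^ 2 ≤ C * imNormPS ρ ^ 3 := by
    rw [pow_succ' _ 2, ← mul_assoc]
    gcongr
  have hCR' := (le_abs_self _).trans ((Complex.abs_im_le_norm _).trans (hCR.trans hCn))
  have hT1' := neg_le_of_abs_le ((Complex.abs_im_le_norm _).trans hT1)
  have hT2' := (le_abs_self _).trans ((Complex.abs_im_le_norm _).trans hT2)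
  simp only [Complex.sub_im, Complex.neg_im, Complex.real_smul, Complex.im_ofReal_mul,
    Complex.I_mul_im] at hCR' hT1' hT2'
  have hn3 : 0 ≤ imNormPS ρ ^ 3 := pow_nonneg (hY0.trans hYn) 3
  have hCn3 := mul_nonneg hC0 hn3
  have hKn3 := mul_nonneg hK0 hn3
  rw [fderiv_Lam_Kvec ha.differentiable, rePS_eq]
  linarith

end
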